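/- Assume the mechanical setting. Let f : ℝⁿ × ℝⁿ × ℝ → ℝ be smooth and let x = (q,p,z) ∈ M×ℝ be a point at which the p-gradient ∇_p f(x) := (∂f/∂p₁(x), …, ∂f/∂pₙ(x)) lies in the constraint distribution D(q). Then the total (Fréchet) derivatives of f∘Γ and of f at x coincide: d(f∘Γ)(x) = df(x) as linear maps ℝⁿ × ℝⁿ × ℝ → ℝ. -/

import Mathlib

open scoped BigOperators Matrix
noncomputable section

/-- Phase space `ℝⁿ × ℝⁿ × ℝ`, modeling `T*Q × ℝ` for `Q = ℝⁿ`. -/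
abbrev PS (n : ℕ) := (Fin n → ℝ) × (Fin n → ℝ) × ℝ

/-- Partial derivative in the `qⁱ` direction. -/
def pdq {n : ℕ} (F : PS n → ℝ) (x : PS n) (i : Fin n) : ℝ :=
  fderiv ℝ F x (Pi.single i 1, 0, 0)

/-- Partial derivative in the `pᵢ` direction. -/
def pdp {n : ℕ} (F : PS n → ℝ) (x : PS n) (i : Fin n) : ℝ :=
  fderiv ℝ F x (0, Pi.single i 1, 0)

/-- Partial derivative in the `z` direction. -/
def pdz {n : ℕ} (F : PS n → ℝ) (x : PS n) : ℝ :=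
  fderiv ℝ F x (0, 0, 1)

/-- The flat map `♭ₓ(v) = ι_v dη + η(v) η` at `x = (q,p,z)`, for `η = dz − Σ pᵢ dqⁱ`;
covectors are identified with triples (dq-components, dp-components, dz-component). -/
def flatMap {n : ℕ} (x : PS n) (v : PS n) : PS n :=
  (fun i => -v.2.1 i - (v.2.2 - ∑ j, x.2.1 j * v.1 j) * x.2.1 i,
   v.1,
   v.2.2 - ∑ j, x.2.1 j * v.1 j)

/-- The contact Hamiltonian vector field of `F`. -/
def XH {n : ℕ} (F : PS n → ℝ) (x : PS n) : PS n :=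
  (fun i => pdp F x i,
   fun i => -pdq F x i - x.2.1 i * pdz F x,
   (∑ i, x.2.1 i * pdp F x i) - F x)

/-- The contact (Jacobi) bracket. -/
def jacB {n : ℕ} (f g : PS n → ℝ) (x : PS n) : ℝ :=
  (∑ i, (pdp f x i * pdq g x i - pdp g x i * pdq f x i))
  + (∑ i, x.2.1 i * (pdp f x i * pdz g x - pdp g x i * pdz f x))
  + g x * pdz f x - f x * pdz g x

/-- The differential of `F` at `x`, as a covector triple. -/
def dCov {n : ℕ} (F : PS n → ℝ) (x : PS n) : PS n :=
  (fun i => pdq F x i, fun i => pdp F x i, pdz F x)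

/-- The contact form `η = dz − Σ pᵢ dqⁱ` at `x`, as a covector triple. -/
def etaCov {n : ℕ} (x : PS n) : PS n :=
  (fun i => -x.2.1 i, 0, 1)

/-- The mechanical setting: a smooth Riemannian metric `G` on `ℝⁿ`, a smooth potential `V`,
and a smooth fiberwise projection `P` (idempotent, `G⁻¹`-symmetric) onto the constraint
subbundle along the annihilator of the constraint distribution. -/
structure MechSetting (n : ℕ) where
  hn : 1 ≤ n
  G : (Fin n → ℝ) → Matrix (Fin n) (Fin n) ℝ
  V : (Fin n → ℝ) × ℝ → ℝ
  P : (Fin n → ℝ) → Matrix (Fin n) (Fin n) ℝ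
  G_smooth : ∀ i j, ContDiff ℝ (⊤ : ℕ∞) (fun q => G q i j)
  G_symm : ∀ q, (G q).IsSymm
  G_posdef : ∀ q, (G q).PosDef
  V_smooth : ContDiff ℝ (⊤ : ℕ∞) V
  P_smooth : ∀ i j, ContDiff ℝ (⊤ : ℕ∞) (fun q => P q i j)
  P_proj : ∀ q, P q * P q = P q
  P_symm : ∀ q, (P q)ᵀ * (G q)⁻¹ = (G q)⁻¹ * P q

namespace MechSetting

variable {n : ℕ} (S : MechSetting n)

/-- The mechanical Hamiltonian `H(q,p,z) = ½ pᵀ G(q)⁻¹ p + V(q,z)`. -/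
def H (x : PS n) : ℝ :=
  (1 / 2) * (∑ i, ∑ j, x.2.1 i * (S.G x.1)⁻¹ i j * x.2.1 j) + S.V (x.1, x.2.2)

/-- The projection `Γ(q,p,z) = (q, P(q)p, z)` onto `M×ℝ`. -/
def Gam (x : PS n) : PS n :=
  (x.1, (S.P x.1).mulVec x.2.1, x.2.2)

/-- Membership in the constraint submanifold `M×ℝ = {(q,p,z) : P(q)p = p}`. -/
def onM (x : PS n) : Prop :=
  (S.P x.1).mulVec x.2.1 = x.2.1

/-- The constraint distribution `D(q) = {G(q)⁻¹ m : P(q) m = m}`. -/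
def Dd (q : Fin n → ℝ) : Set (Fin n → ℝ) :=
  {v | ∃ m, (S.P q).mulVec m = m ∧ v = ((S.G q)⁻¹).mulVec m}

/-- Entrywise partial derivative `∂P/∂qⁱ` of the matrix-valued map `P`. -/
def dP (q : Fin n → ℝ) (i : Fin n) : Matrix (Fin n) (Fin n) ℝ :=
  fun j k => fderiv ℝ (fun q' => S.P q' j k) q (Pi.single i 1)

end MechSetting

/-- The annihilator `D° = {α ∈ ℝⁿ : Σᵢ αᵢ vᵢ = 0 for all v ∈ D}` of a subspace `D ⊆ ℝⁿ`. -/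
def annih {n : ℕ} (D : Submodule ℝ (Fin n → ℝ)) : Submodule ℝ (Fin n → ℝ) where
  carrier := {α | ∀ v ∈ D, ∑ i, α i * v i = 0}
  zero_mem' := by intro v hv; simp
  add_mem' := by
    intro a b ha hb v hv
    have h1 := ha v hv
    have h2 := hb v hv
    simp only [Pi.add_apply, add_mul, Finset.sum_add_distrib, h1, h2, add_zero]
  smul_mem' := by
    intro c a ha v hv
    simp only [Pi.smul_apply, smul_eq_mul, mul_assoc, ← Finset.mul_sum, ha v hv, mul_zero]

namespace MechSetting

variable {n : ℕ} (S : MechSetting n)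

theorem Gam_eq_self {x : PS n} (hx : S.onM x) : S.Gam x = x :=
  Prod.ext rfl (Prod.ext hx rfl)

theorem Gam_comp_Gam : S.Gam ∘ S.Gam = S.Gam := by
  funext y
  simp [Gam, Matrix.mulVec_mulVec, S.P_proj]

theorem differentiable_Gam : Differentiable ℝ S.Gam := by
  have hP : ∀ i j, Differentiable ℝ fun q => S.P q i j := fun i j =>
    (S.P_smooth i j).differentiable (by simp)
  refine differentiable_fst.prodMk (Differentiable.prodMk ?_ (by fun_prop))
  rw [differentiable_pi]
  intro i
  simp only [Matrix.mulVec, dotProduct]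
  refine Differentiable.fun_sum fun j _ => ?_
  exact ((hP i j).comp differentiable_fst).mul (by fun_prop)

theorem fderiv_Gam_fst (x v : PS n) : (fderiv ℝ S.Gam x v).1 = v.1 := by
  have h := (S.differentiable_Gam x).hasFDerivAt.fst
  have h' : HasFDerivAt (fun y : PS n => (S.Gam y).1) (ContinuousLinearMap.fst ℝ _ _) x :=
    hasFDerivAt_fst
  exact congrArg (fun L => L v) (h.unique h')

theorem fderiv_Gam_snd_snd (x v : PS n) : (fderiv ℝ S.Gam x v).2.2 = v.2.2 := by
  have h := (S.differentiable_Gam x).hasFDerivAt.snd.snd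
  have h' : HasFDerivAt (fun y : PS n => (S.Gam y).2.2)
      ((ContinuousLinearMap.snd ℝ _ _).comp (ContinuousLinearMap.snd ℝ _ _)) x :=
    ((ContinuousLinearMap.snd ℝ (Fin n → ℝ) ℝ).comp
      (ContinuousLinearMap.snd ℝ (Fin n → ℝ) ((Fin n → ℝ) × ℝ))).hasFDerivAt
  exact congrArg (fun L => L v) (h.unique h')

/-- Along a fibre of momenta, `Γ` is affine with linear part `P(q)`. -/
theorem fderiv_Gam_momentum (x : PS n) (u : Fin n → ℝ) :
    fderiv ℝ S.Gam x (0, u, 0) = (0, (S.P x.1).mulVec u, 0) := by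
  have hline : HasDerivAt (fun t : ℝ => x + t • ((0, u, 0) : PS n)) (0, u, 0) 0 := by
    simpa using ((hasDerivAt_id (0 : ℝ)).smul_const ((0, u, 0) : PS n)).const_add x
  have hGam : HasFDerivAt S.Gam (fderiv ℝ S.Gam x) (x + (0 : ℝ) • ((0, u, 0) : PS n)) := by
    simpa using (S.differentiable_Gam x).hasFDerivAt
  have h := hGam.comp_hasDerivAt (0 : ℝ) hline
  have h' : HasDerivAt (S.Gam ∘ fun t : ℝ => x + t • ((0, u, 0) : PS n))
      (0, (S.P x.1).mulVec u, 0) 0 := by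
    have : (S.Gam ∘ fun t : ℝ => x + t • ((0, u, 0) : PS n)) =
        fun t : ℝ => S.Gam x + t • ((0, (S.P x.1).mulVec u, 0) : PS n) := by
      funext t
      simp [Gam, Matrix.mulVec_add, Matrix.mulVec_smul]
    rw [this]
    simpa using ((hasDerivAt_id (0 : ℝ)).smul_const
      ((0, (S.P x.1).mulVec u, 0) : PS n)).const_add (S.Gam x)
  exact h.unique h'

/-- Elements of the constraint distribution are fixed by the transpose of the projection. -/
theorem vecMul_P_of_mem_Dd {q a : Fin n → ℝ} (ha : a ∈ S.Dd q) : Matrix.vecMul a (S.P q) = a := by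
  obtain ⟨m, hm, rfl⟩ := ha
  rw [← Matrix.mulVec_transpose, Matrix.mulVec_mulVec, S.P_symm, ← Matrix.mulVec_mulVec, hm]

end MechSetting

theorem fderiv_momentum_eq_dotProduct {n : ℕ} (f : PS n → ℝ) (x : PS n) (u : Fin n → ℝ) :
    fderiv ℝ f x (0, u, 0) = (fun i => pdp f x i) ⬝ᵥ u := by
  let ι : (Fin n → ℝ) →ₗ[ℝ] PS n :=
    LinearMap.inr ℝ (Fin n → ℝ) ((Fin n → ℝ) × ℝ) ∘ₗ LinearMap.inl ℝ (Fin n → ℝ) ℝ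
  have h := LinearMap.pi_apply_eq_sum_univ ((fderiv ℝ f x).toLinearMap ∘ₗ ι) u
  have hs : ∀ i : Fin n, (fun j => if i = j then (1 : ℝ) else 0) = Pi.single i 1 := by
    intro i
    funext j
    simp [Pi.single_apply, eq_comm]
  simp only [hs] at h
  simpa [ι, dotProduct, pdp, mul_comm] using h

/-- if the `p`-gradient of `f` at `x ∈ M×ℝ` lies in the constraint
distribution `D(q)`, then `d(f∘Γ)(x) = df(x)`. -/
theorem statement_16 {n : ℕ} (S : MechSetting n)
    (f : PS n → ℝ) (hf : ContDiff ℝ (⊤ : ℕ∞) f) (x : PS n) (hx : S.onM x)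
    (hmech : (fun i => pdp f x i) ∈ S.Dd x.1) :
    fderiv ℝ (f ∘ S.Gam) x = fderiv ℝ f x := by
  have hfix := S.Gam_eq_self hx
  have hΓ := S.differentiable_Gam x
  have hf' : DifferentiableAt ℝ f (S.Gam x) := (hf.differentiable (by simp)) _
  have hΓ' : DifferentiableAt ℝ S.Gam (S.Gam x) := S.differentiable_Gam _
  have hidem : (fderiv ℝ S.Gam x).comp (fderiv ℝ S.Gam x) = fderiv ℝ S.Gam x := by
    have h := fderiv_comp x hΓ' hΓ
    rw [S.Gam_comp_Gam, hfix] at h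
    exact h.symm
  rw [fderiv_comp x hf' hΓ, hfix]
  refine ContinuousLinearMap.ext fun v => ?_
  rw [ContinuousLinearMap.comp_apply, ← sub_eq_zero, ← map_sub]
  obtain ⟨u, hu⟩ : ∃ u, fderiv ℝ S.Gam x v - v = (0, u, 0) :=
    ⟨(fderiv ℝ S.Gam x v - v).2.1, Prod.ext (by simp [S.fderiv_Gam_fst])
      (Prod.ext rfl (by simp [S.fderiv_Gam_snd_snd]))⟩
  have hker : fderiv ℝ S.Gam x (0, u, 0) = 0 := by
    rw [← hu, map_sub, ← ContinuousLinearMap.comp_apply, hidem, sub_self]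
  have hPu : (S.P x.1).mulVec u = 0 := by
    rw [S.fderiv_Gam_momentum] at hker
    exact congrArg (fun y => y.2.1) hker
  rw [hu, fderiv_momentum_eq_dotProduct, ← S.vecMul_P_of_mem_Dd hmech,
    ← Matrix.dotProduct_mulVec, hPu, dotProduct_zero]
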